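/- Let h ≥ 2 be an integer, let V be a finite vertex set with |V| = n, and let γ, σ ∈ (0, 1/2). Let G and G' be simple graphs on V, and define ℓ = ℓ_h(G) = max over unordered pairs {i,j} ⊆ V of the number of h-element subsets V' ⊆ V containing i and j such that every pair of vertices of V' other than {i,j} is an edge of G. For each h-element subset I ⊆ V define χ(I) = 1 if I induces a clique in G but not in G', χ(I) = −1 if I induces a clique in G' but not in G, and χ(I) = 0 otherwise. Assume: (1) the symmetric difference of the edge sets satisfies |E(G) Δ E(G')| ≥ σ γ n²; (2) in both G and G', every vertex has degree in [γn/2, 2γn]; (3) every edge of G lies in between ℓ/2 and 2ℓ h-cliques of G, and every edge of G' lies in between ℓ/2 and 2ℓ h-cliques of G'; (4) for every 1 ≤ i ≤ h and every i-element subset B ⊆ V, the number of vertices adjacent in G to all vertices of B lies in [nγ^i/2, 2nγ^i], and the same holds in G'. Then there exist disjoint subsets P, Q ⊆ V with | Σ_{t ∈ P} Σ_{B ⊆ Q, |B| = h−1} χ({t} ∪ B) | ≥ 2^{−h²−h−7} · σ · γ^{1/2} · n^{3/2} · ℓ. -/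

import Mathlib

open Finset
open scoped Classical

variable {V : Type*} [Fintype V] [DecidableEq V]

/-- Number of `h`-element subsets containing both `i` and `j` in which every pair of
vertices other than `{i,j}` is an edge of `G`. -/
noncomputable def khPairCount (h : ℕ) (G : SimpleGraph V) (i j : V) : ℕ :=
  ((Finset.univ.powersetCard h).filter
    (fun V' => i ∈ V' ∧ j ∈ V' ∧
      ∀ a ∈ V', ∀ b ∈ V', a ≠ b → s(a, b) ≠ s(i, j) → G.Adj a b)).card

/-- Local sensitivity `ℓ_h(G)` of `K_h`-motif cuts of the unweighted graph `G`. -/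
noncomputable def ellh (h : ℕ) (G : SimpleGraph V) : ℝ :=
  ⨆ p : V × V, if p.1 ≠ p.2 then (khPairCount h G p.1 p.2 : ℝ) else 0

/-- The number of `h`-cliques of `G` containing both `a` and `b`. -/
noncomputable def cliqueCountOnEdge (h : ℕ) (G : SimpleGraph V) (a b : V) : ℕ :=
  ((Finset.univ.powersetCard h).filter
    (fun I => a ∈ I ∧ b ∈ I ∧ G.IsNClique h I)).card

/-- The set of common neighbours of `B` in `G`. -/
noncomputable def commonNbrs (G : SimpleGraph V) (B : Finset V) : Finset V :=
  Finset.univ.filter fun t => ∀ b ∈ B, G.Adj t b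

/-- The degree of a vertex. -/
noncomputable def degreeCount (G : SimpleGraph V) (v : V) : ℕ :=
  (Finset.univ.filter fun u => G.Adj v u).card

/-- The edge set of `G` as a finset of unordered pairs. -/
noncomputable def edgeFinset' (G : SimpleGraph V) : Finset (Sym2 V) :=
  Finset.univ.filter fun e => e ∈ G.edgeSet

/-- The coloring: +1 on `h`-cliques of `G` that are not `h`-cliques of `G'`,
−1 on `h`-cliques of `G'` that are not `h`-cliques of `G`, and 0 otherwise. -/
noncomputable def chiColor (h : ℕ) (G G' : SimpleGraph V) (I : Finset V) : ℝ :=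
  if G.IsNClique h I ∧ ¬ G'.IsNClique h I then 1
  else if G'.IsNClique h I ∧ ¬ G.IsNClique h I then -1
  else 0

/-- A real polynomial of degree at most `d` that is bounded by `M` on `[-1, 1]` has linear
coefficient at most `3 ^ d * M`. -/
theorem abs_linear_coeff_le (d : ℕ) : ∀ (a : ℕ → ℝ) (M : ℝ),
    (∀ r : ℝ, |r| ≤ 1 → |∑ k ∈ range (d + 1), a k * r ^ k| ≤ M) → 1 ≤ d →
      |a 1| ≤ 3 ^ d * M := by
  induction d with
  | zero => intro a M _ hd; omega
  | succ d ih =>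
    intro a M hM _
    have hM0 : 0 ≤ M := (abs_nonneg _).trans (hM 0 (by simp))
    by_cases hd : d ≤ 1
    · have h1 := hM 1 (by simp)
      have h2 := hM (-1) (by simp)
      have h3 : |a 1| ≤ M := by
        interval_cases d
        · norm_num [sum_range_succ] at h1 h2 ⊢
          rw [abs_le] at *
          constructor <;> linarith
        · norm_num [sum_range_succ] at h1 h2 ⊢
          rw [abs_le] at *
          constructor <;> linarith
      have h4 : (1 : ℝ) ≤ 3 ^ (d + 1) := one_le_pow₀ (by norm_num)
      nlinarith
    · -- `p r - 2 ^ (d + 1) * p (r / 2)` has degree at most `d`.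
      set b : ℕ → ℝ := fun k => a k * (1 - 2 ^ (d + 1) / 2 ^ k) with hb
      have key := ih b ((1 + 2 ^ (d + 1)) * M) (fun r hr => by
        have h1 := hM r hr
        have h2 := hM (r / 2) (by rw [abs_div]; norm_num; linarith)
        have h3 : ∑ k ∈ range (d + 1), b k * r ^ k
            = ∑ k ∈ range (d + 2), a k * r ^ k
              - 2 ^ (d + 1) * ∑ k ∈ range (d + 2), a k * (r / 2) ^ k := by
          have : ∑ k ∈ range (d + 1), b k * r ^ k = ∑ k ∈ range (d + 2), b k * r ^ k := by
            rw [sum_range_succ _ (d + 1)]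
            simp [hb]
          rw [this, mul_sum, ← sum_sub_distrib]
          refine sum_congr rfl fun k _ => ?_
          simp only [hb, div_pow]
          ring
        rw [h3]
        calc _ ≤ |∑ k ∈ range (d + 2), a k * r ^ k|
              + |2 ^ (d + 1) * ∑ k ∈ range (d + 2), a k * (r / 2) ^ k| := abs_sub _ _
          _ ≤ M + 2 ^ (d + 1) * M := by
            rw [abs_mul, abs_of_pos (by positivity : (0 : ℝ) < 2 ^ (d + 1))]
            gcongr
          _ = _ := by ring) (by omega)
      have hb1 : |b 1| = |a 1| * (2 ^ d - 1) := by
        have : b 1 = -(a 1 * (2 ^ d - 1)) := by simp only [hb, pow_succ]; ring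
        have h1 : (1 : ℝ) ≤ 2 ^ d := one_le_pow₀ (by norm_num)
        rw [this, abs_neg, abs_mul, abs_of_nonneg (by linarith : (0 : ℝ) ≤ 2 ^ d - 1)]
      have h4 : (4 : ℝ) ≤ 2 ^ d := by
        calc (4 : ℝ) = 2 ^ 2 := by norm_num
          _ ≤ 2 ^ d := pow_le_pow_right₀ (by norm_num) (by omega)
      have h5 : |a 1| * (2 ^ d - 1) ≤ 3 ^ (d + 1) * M * (2 ^ d - 1) := by
        rw [← hb1]
        refine key.trans ?_
        have h6 : (0 : ℝ) ≤ 3 ^ d * M := by positivity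
        rw [pow_succ, pow_succ]
        nlinarith
      exact le_of_mul_le_mul_right h5 (by linarith)

/-- Independent rounding: a bound on `∑ t ∈ P, ∑ B ⊆ Q, W t B` over all disjoint `P`, `Q`
extends to fractional memberships `p`, `q` with `p + q ≤ 1`. -/
theorem abs_fractional_cut_le {d : ℕ} {W : V → Finset V → ℝ}
    (hW : ∀ t B, t ∈ B → W t B = 0) {M : ℝ}
    (hM : ∀ P Q : Finset V, Disjoint P Q → |∑ t ∈ P, ∑ B ∈ Q.powersetCard d, W t B| ≤ M)
    {p q : V → ℝ} (hp : ∀ v, 0 ≤ p v) (hq : ∀ v, 0 ≤ q v) (hpq : ∀ v, p v + q v ≤ 1) :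
    |∑ t, ∑ B ∈ univ.powersetCard d, p t * (∏ v ∈ B, q v) * W t B| ≤ M := by
  set w : V → Option Bool → ℝ := fun v s => s.elim (1 - p v - q v) fun b => bif b then p v else q v
    with hw
  have hw0 : ∀ v s, 0 ≤ w v s := by
    rintro v (_ | _ | _)
    · simp only [hw, Option.elim]; linarith [hpq v]
    · exact hq v
    · exact hp v
  have hw1 : ∑ s : V → Option Bool, ∏ v, w v (s v) = 1 := by
    rw [← Fintype.prod_sum]
    refine prod_eq_one fun v _ => ?_
    simp [Fintype.sum_option, hw]
  set g : V → Finset V → V → Option Bool → ℝ := fun t B v s =>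
    if v = t then (if s = some true then 1 else 0)
    else if v ∈ B then (if s = some false then 1 else 0) else 1 with hg
  have hmarg : ∀ t B, t ∉ B →
      p t * ∏ v ∈ B, q v = ∑ s : V → Option Bool, ∏ v, (w v (s v) * g t B v (s v)) := by
    intro t B ht
    rw [← Fintype.prod_sum (fun v s => w v s * g t B v s)]
    have h1 : ∀ v, ∑ s, w v s * g t B v s
        = (if v = t then p v else 1) * (if v ∈ B then q v else 1) := by
      intro v
      by_cases hv : v = t
      · subst hv
        simp [hw, hg, ht]
      · by_cases hvB : v ∈ B
        · simp [hw, hg, hv, hvB]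
        · simp [Fintype.sum_option, hw, hg, hv, hvB]
    simp_rw [h1]
    rw [prod_mul_distrib]
    simp
  have hcut : ∀ s : V → Option Bool,
      ∑ t, ∑ B ∈ univ.powersetCard d, (∏ v, g t B v (s v)) * W t B
        = ∑ t ∈ univ.filter (fun v => s v = some true),
            ∑ B ∈ (univ.filter (fun v => s v = some false)).powersetCard d, W t B := by
    intro s
    rw [sum_filter]
    refine sum_congr rfl fun t _ => ?_
    split_ifs with ht
    · have hsub : (univ.filter (fun v => s v = some false)).powersetCard d
          ⊆ (univ : Finset V).powersetCard d := powersetCard_mono (subset_univ _)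
      rw [← sum_subset hsub]
      · refine sum_congr rfl fun B hB => ?_
        rw [mem_powersetCard] at hB
        rw [prod_eq_one, one_mul]
        intro v _
        by_cases hv : v = t
        · subst hv; simp [hg, ht]
        · by_cases hvB : v ∈ B
          · have := hB.1 hvB
            simp only [mem_filter, mem_univ, true_and] at this
            simp [hg, hv, this]
          · simp [hg, hv, hvB]
      · intro B hB hB'
        by_cases htB : t ∈ B
        · rw [hW t B htB, mul_zero]
        · have : ∃ v ∈ B, s v ≠ some false := by
            by_contra hcon
            push Not at hcon
            exact hB' (mem_powersetCard.2
              ⟨fun v hv => by simp [hcon v hv], (mem_powersetCard.1 hB).2⟩)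
          obtain ⟨v, hvB, hsv⟩ := this
          rw [prod_eq_zero (mem_univ v), zero_mul]
          have hvt : v ≠ t := by rintro rfl; exact htB hvB
          simp [hg, hvt, hvB, hsv]
    · refine sum_eq_zero fun B _ => ?_
      rw [prod_eq_zero (mem_univ t), zero_mul]
      simp [hg, ht]
  have hexp : ∑ t, ∑ B ∈ univ.powersetCard d, p t * (∏ v ∈ B, q v) * W t B
      = ∑ s : V → Option Bool, (∏ v, w v (s v)) *
          ∑ t, ∑ B ∈ univ.powersetCard d, (∏ v, g t B v (s v)) * W t B := by
    simp_rw [mul_sum]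
    symm
    rw [sum_comm]
    refine sum_congr rfl fun t _ => ?_
    rw [sum_comm]
    refine sum_congr rfl fun B _ => ?_
    by_cases ht : t ∈ B
    · simp [hW t B ht]
    · rw [hmarg t B ht, sum_mul]
      refine sum_congr rfl fun s _ => ?_
      rw [prod_mul_distrib]
      ring
  rw [hexp]
  calc _ ≤ ∑ s : V → Option Bool, |(∏ v, w v (s v)) *
          ∑ t, ∑ B ∈ univ.powersetCard d, (∏ v, g t B v (s v)) * W t B| := abs_sum_le_sum_abs _ _
    _ ≤ ∑ s : V → Option Bool, (∏ v, w v (s v)) * M := by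
      refine sum_le_sum fun s _ => ?_
      rw [abs_mul, abs_of_nonneg (prod_nonneg fun v _ => hw0 v _), hcut]
      refine mul_le_mul_of_nonneg_left (hM _ _ ?_) (prod_nonneg fun v _ => hw0 v _)
      rw [disjoint_filter]
      intro v _ h1 h2
      simp [h1] at h2
    _ = M := by rw [← sum_mul, hw1, one_mul]

/-- The linear part of a cut functional at a point of the cube is controlled by its maximum over
disjoint pairs of sets. -/
theorem sum_abs_linear_part_le {d : ℕ} (hd : 1 ≤ d) {W : V → Finset V → ℝ}
    (hW : ∀ t B, t ∈ B → W t B = 0) {M : ℝ}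
    (hM : ∀ P Q : Finset V, Disjoint P Q → |∑ t ∈ P, ∑ B ∈ Q.powersetCard d, W t B| ≤ M)
    {x : V → ℝ} (hx : ∀ v, |x v| ≤ 1) :
    ∑ t, |∑ B ∈ univ.powersetCard d, W t B * ∑ v ∈ B, x v| ≤ 4 * 12 ^ d * M := by
  set L : V → ℝ := fun t => ∑ B ∈ univ.powersetCard d, W t B * ∑ v ∈ B, x v with hL
  have half : ∀ p : V → ℝ, (∀ v, 0 ≤ p v) → (∀ v, p v ≤ 1 / 2) →
      |∑ t, p t * L t| ≤ 12 ^ d * M := by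
    intro p hp hp'
    set a : ℕ → ℝ := fun k => ∑ t, ∑ B ∈ univ.powersetCard d,
      p t * ((1 / 4) ^ d * ∑ S ∈ B.powersetCard k, ∏ v ∈ S, x v) * W t B with ha
    have key := abs_linear_coeff_le d a M (fun r hr => by
      have hrx : ∀ v, |r * x v| ≤ 1 := fun v => by
        rw [abs_mul]; exact mul_le_one₀ hr (abs_nonneg _) (hx v)
      have h1 := abs_fractional_cut_le hW hM (p := p) (q := fun v => 1 / 4 * (1 + r * x v)) hp
        (fun v => by have := (abs_le.1 (hrx v)).1; linarith)
        (fun v => by have := (abs_le.1 (hrx v)).2; have := hp' v; linarith)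
      convert h1 using 2
      simp only [ha, sum_mul]
      rw [sum_comm]
      refine sum_congr rfl fun t _ => ?_
      rw [sum_comm]
      refine sum_congr rfl fun B hB => ?_
      have hBc := (mem_powersetCard.1 hB).2
      rw [prod_mul_distrib, prod_const, hBc, prod_one_add, sum_powerset, hBc, mul_sum, mul_sum,
        sum_mul]
      refine sum_congr rfl fun k _ => ?_
      have h2 : ∑ S ∈ B.powersetCard k, ∏ v ∈ S, r * x v
          = r ^ k * ∑ S ∈ B.powersetCard k, ∏ v ∈ S, x v := by
        rw [mul_sum]
        refine sum_congr rfl fun S hS => ?_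
        rw [prod_mul_distrib, prod_const, (mem_powersetCard.1 hS).2]
      rw [h2]
      ring) hd
    have ha1 : a 1 = (1 / 4) ^ d * ∑ t, p t * L t := by
      simp only [ha, hL, mul_sum, powersetCard_one, sum_map, Function.Embedding.coeFn_mk,
        prod_singleton, sum_mul]
      refine sum_congr rfl fun t _ => sum_congr rfl fun B _ => sum_congr rfl fun v _ => ?_
      ring
    rw [ha1, abs_mul, abs_of_nonneg (by positivity)] at key
    calc |∑ t, p t * L t| = 4 ^ d * ((1 / 4) ^ d * |∑ t, p t * L t|) := by
          rw [← mul_assoc, ← mul_pow]; norm_num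
      _ ≤ 4 ^ d * (3 ^ d * M) := by gcongr
      _ = 12 ^ d * M := by rw [← mul_assoc, ← mul_pow]; norm_num
  have h1 := half (fun t => if 0 ≤ L t then 1 / 2 else 0)
    (fun v => by split_ifs <;> norm_num) (fun v => by split_ifs <;> norm_num)
  have h2 := half (fun t => if 0 ≤ L t then 0 else 1 / 2)
    (fun v => by split_ifs <;> norm_num) (fun v => by split_ifs <;> norm_num)
  have h3 : ∑ t, |L t| = 2 * (∑ t, (if 0 ≤ L t then 1 / 2 else 0) * L t)
      - 2 * ∑ t, (if 0 ≤ L t then 0 else 1 / 2) * L t := by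
    rw [mul_sum, mul_sum, ← sum_sub_distrib]
    refine sum_congr rfl fun t _ => ?_
    split_ifs with ht
    · rw [abs_of_nonneg ht]; ring
    · rw [abs_of_neg (not_le.1 ht)]; ring
  change ∑ t, |L t| ≤ _
  rw [h3]
  linarith [(abs_le.1 h1).2, (abs_le.1 h2).1]

/-- The sign vector of a subset. -/
noncomputable def signVec (X : Finset V) (v : V) : ℝ := if v ∈ X then 1 else -1

omit [Fintype V] in
theorem sum_powerset_insert_rademacher (a : V → ℝ) (F : ℝ → ℝ) {S : Finset V} {u : V}
    (hu : u ∉ S) :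
    ∑ X ∈ (insert u S).powerset, F (∑ v ∈ insert u S, a v * signVec X v)
      = ∑ X ∈ S.powerset, (F (∑ v ∈ S, a v * signVec X v - a u)
          + F (∑ v ∈ S, a v * signVec X v + a u)) := by
  rw [sum_powerset_insert hu, ← sum_add_distrib]
  refine sum_congr rfl fun X hX => ?_
  have huX : u ∉ X := fun h => hu (mem_powerset.1 hX h)
  have h1 : ∑ v ∈ S, a v * signVec (insert u X) v = ∑ v ∈ S, a v * signVec X v := by
    refine sum_congr rfl fun v hv => ?_
    have : v ≠ u := by rintro rfl; exact hu hv
    simp [signVec, this]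
  rw [sum_insert hu, sum_insert hu, h1]
  simp only [signVec, huX, mem_insert_self, if_true, if_false]
  congr 2 <;> ring

omit [Fintype V] in
theorem rademacher_sq (a : V → ℝ) (S : Finset V) :
    ∑ X ∈ S.powerset, (∑ v ∈ S, a v * signVec X v) ^ 2 = 2 ^ S.card * ∑ v ∈ S, a v ^ 2 := by
  induction S using Finset.induction_on with
  | empty => simp
  | insert u S hu ih =>
    rw [sum_powerset_insert_rademacher a (· ^ 2) hu, card_insert_of_notMem hu, sum_insert hu]
    have : ∀ y : ℝ, (y - a u) ^ 2 + (y + a u) ^ 2 = 2 * y ^ 2 + 2 * a u ^ 2 := fun y => by ring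
    simp_rw [this]
    rw [sum_add_distrib, ← mul_sum, ih, sum_const, card_powerset, nsmul_eq_mul]
    push_cast
    ring

omit [Fintype V] in
theorem rademacher_pow_four_le (a : V → ℝ) (S : Finset V) :
    ∑ X ∈ S.powerset, (∑ v ∈ S, a v * signVec X v) ^ 4
      ≤ 3 * 2 ^ S.card * (∑ v ∈ S, a v ^ 2) ^ 2 := by
  induction S using Finset.induction_on with
  | empty => simp
  | insert u S hu ih =>
    rw [sum_powerset_insert_rademacher a (· ^ 4) hu, card_insert_of_notMem hu, sum_insert hu]
    have : ∀ y : ℝ, (y - a u) ^ 4 + (y + a u) ^ 4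
        = 2 * y ^ 4 + 12 * a u ^ 2 * y ^ 2 + 2 * a u ^ 4 := fun y => by ring
    simp_rw [this]
    rw [sum_add_distrib, sum_add_distrib, ← mul_sum, ← mul_sum, rademacher_sq, sum_const,
      card_powerset, nsmul_eq_mul]
    push_cast
    have h1 : (0 : ℝ) ≤ 2 ^ S.card * a u ^ 4 := by positivity
    rw [pow_succ (2 : ℝ)]
    linear_combination 2 * ih + 4 * h1

omit [Fintype V] in
/-- The Khintchine inequality for the first moment, with constant `5 / 9`. -/
theorem rademacher_abs_ge (a : V → ℝ) (S : Finset V) :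
    5 / 9 * 2 ^ S.card * √(∑ v ∈ S, a v ^ 2) ≤ ∑ X ∈ S.powerset, |∑ v ∈ S, a v * signVec X v| := by
  set A := √(∑ v ∈ S, a v ^ 2) with hA
  have hA2 : A ^ 2 = ∑ v ∈ S, a v ^ 2 := Real.sq_sqrt (sum_nonneg fun v _ => sq_nonneg _)
  rcases (Real.sqrt_nonneg (∑ v ∈ S, a v ^ 2)).eq_or_lt with h0 | hpos
  · rw [← hA] at h0
    rw [← h0, mul_zero]
    exact sum_nonneg fun _ _ => abs_nonneg _
  · rw [← hA] at hpos
    have pointwise : ∀ y : ℝ, A ^ 2 * y ^ 2 - 4 / 27 * y ^ 4 ≤ A ^ 3 * |y| := by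
      intro y
      have h1 : 0 ≤ |y| := abs_nonneg y
      have h2 : 0 ≤ |y| * ((|y| - 3 / 2 * A) ^ 2 * (|y| + 3 * A)) := by positivity
      have h3 : y ^ 2 = |y| ^ 2 := (sq_abs y).symm
      have h4 : y ^ 4 = |y| ^ 4 := by rw [show y ^ 4 = (y ^ 2) ^ 2 by ring, h3]; ring
      rw [h3, h4]
      nlinarith
    have hsum := sum_le_sum fun X (_ : X ∈ S.powerset) => pointwise (∑ v ∈ S, a v * signVec X v)
    rw [sum_sub_distrib, ← mul_sum, ← mul_sum, ← mul_sum, rademacher_sq] at hsum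
    have h4 := rademacher_pow_four_le a S
    rw [← hA2] at hsum h4
    have h5 : A ^ 3 * (5 / 9 * 2 ^ S.card * A)
        ≤ A ^ 3 * ∑ X ∈ S.powerset, |∑ v ∈ S, a v * signVec X v| := by
      nlinarith
    exact le_of_mul_le_mul_left h5 (by positivity)

/-- Summing over `h - 1`-sets `B ∌ t` through `v`
is the same as summing over `h`-sets through `t` and `v`. -/
theorem sum_powersetCard_insert_eq {h : ℕ} (hh : 1 ≤ h) (f : Finset V → ℝ) {t v : V}
    (htv : t ≠ v) :
    ∑ B ∈ univ.powersetCard (h - 1) with t ∉ B ∧ v ∈ B, f (insert t B)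
      = ∑ I ∈ univ.powersetCard h with t ∈ I ∧ v ∈ I, f I := by
  refine sum_nbij' (fun B => insert t B) (fun I => I.erase t) ?_ ?_ ?_ ?_ ?_
  · intro B hB
    simp only [mem_filter, mem_powersetCard_univ] at hB ⊢
    refine ⟨?_, mem_insert_self _ _, mem_insert_of_mem hB.2.2⟩
    rw [card_insert_of_notMem hB.2.1]
    omega
  · intro I hI
    simp only [mem_filter, mem_powersetCard_univ] at hI ⊢
    refine ⟨?_, notMem_erase _ _, mem_erase.2 ⟨htv.symm, hI.2.2⟩⟩
    rw [card_erase_of_mem hI.2.1, hI.1]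
  · intro B hB
    exact erase_insert (mem_filter.1 hB).2.1
  · intro I hI
    exact insert_erase (mem_filter.1 hI).2.1
  · intro B _
    rfl

omit [Fintype V] [DecidableEq V] in
theorem not_isNClique_of_not_adj {G : SimpleGraph V} {h : ℕ} {I : Finset V} {t v : V}
    (ht : t ∈ I) (hv : v ∈ I) (htv : t ≠ v) (hadj : ¬ G.Adj t v) : ¬ G.IsNClique h I :=
  fun hI => hadj (hI.isClique ht hv htv)

theorem sum_chiColor_of_adj_left {h : ℕ} {G G' : SimpleGraph V} {t v : V} (hG : G.Adj t v)
    (hG' : ¬ G'.Adj t v) :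
    ∑ I ∈ univ.powersetCard h with t ∈ I ∧ v ∈ I, chiColor h G G' I = cliqueCountOnEdge h G t v := by
  rw [cliqueCountOnEdge, card_filter, sum_filter, Nat.cast_sum]
  refine sum_congr rfl fun I _ => ?_
  by_cases hI : t ∈ I ∧ v ∈ I
  · have := not_isNClique_of_not_adj (h := h) hI.1 hI.2 hG.ne hG'
    by_cases hc : G.IsNClique h I <;> simp [chiColor, hI, this, hc]
  · rw [if_neg hI, if_neg fun hc => hI ⟨hc.1, hc.2.1⟩, Nat.cast_zero]

omit [Fintype V] in
theorem chiColor_swap (h : ℕ) (G G' : SimpleGraph V) (I : Finset V) :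
    chiColor h G' G I = -chiColor h G G' I := by
  unfold chiColor
  by_cases h1 : G.IsNClique h I <;> by_cases h2 : G'.IsNClique h I <;> simp [h1, h2]

theorem sum_degree_symmDiff (G G' : SimpleGraph V) :
    ∑ t, #{v | (G.Adj t v ∧ ¬ G'.Adj t v) ∨ (G'.Adj t v ∧ ¬ G.Adj t v)}
      = 2 * #(symmDiff (edgeFinset' G) (edgeFinset' G')) := by
  have h1 := (symmDiff G G').sum_degrees_eq_twice_card_edges
  have h2 : (symmDiff G G').edgeFinset = symmDiff (edgeFinset' G) (edgeFinset' G') := by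
    ext e
    induction e with
    | h a b =>
      rw [SimpleGraph.mem_edgeFinset]
      simp [edgeFinset', symmDiff]
  rw [h2] at h1
  rw [← h1]
  refine sum_congr rfl fun t _ => ?_
  rw [← SimpleGraph.card_neighborFinset_eq_degree]
  congr 1
  ext v
  rw [SimpleGraph.mem_neighborFinset]
  simp [symmDiff]

theorem abs_linear_coeff_ge {h : ℕ} {G G' : SimpleGraph V} {ℓ : ℝ}
    (hcl : ∀ a b : V, G.Adj a b → ℓ ≤ (cliqueCountOnEdge h G a b : ℝ))
    (hcl' : ∀ a b : V, G'.Adj a b → ℓ ≤ (cliqueCountOnEdge h G' a b : ℝ)) {t v : V}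
    (htv : (G.Adj t v ∧ ¬ G'.Adj t v) ∨ (G'.Adj t v ∧ ¬ G.Adj t v)) :
    ℓ ≤ |∑ I ∈ univ.powersetCard h with t ∈ I ∧ v ∈ I, chiColor h G G' I| := by
  rcases htv with htv | htv
  · rw [sum_chiColor_of_adj_left htv.1 htv.2]
    exact (hcl t v htv.1).trans (le_abs_self _)
  · simp_rw [chiColor_swap h G' G, sum_neg_distrib, abs_neg]
    rw [sum_chiColor_of_adj_left htv.1 htv.2]
    exact (hcl' t v htv.1).trans (le_abs_self _)

/-- If every edge of `G` and `G'` lies in at least `ℓ` cliques, then the discrepancy of `chiColor`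
is at least of order `ℓ * ∑ t, √(deg t)`, the degrees being those in the symmetric difference. -/
theorem sum_sqrt_degree_symmDiff_le {h : ℕ} (hh : 2 ≤ h) {G G' : SimpleGraph V} {ℓ M : ℝ}
    (hℓ : 0 ≤ ℓ)
    (hcl : ∀ a b : V, G.Adj a b → ℓ ≤ (cliqueCountOnEdge h G a b : ℝ))
    (hcl' : ∀ a b : V, G'.Adj a b → ℓ ≤ (cliqueCountOnEdge h G' a b : ℝ))
    (hM : ∀ P Q : Finset V, Disjoint P Q →
      |∑ t ∈ P, ∑ B ∈ Q.powersetCard (h - 1), chiColor h G G' (insert t B)| ≤ M) :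
    5 / 9 * ℓ * ∑ t : V, √(#{v | (G.Adj t v ∧ ¬ G'.Adj t v) ∨ (G'.Adj t v ∧ ¬ G.Adj t v)} : ℝ)
      ≤ 4 * 12 ^ (h - 1) * M := by
  set D : V → Finset V := fun t =>
    {v | (G.Adj t v ∧ ¬ G'.Adj t v) ∨ (G'.Adj t v ∧ ¬ G.Adj t v)} with hD
  set W : V → Finset V → ℝ := fun t B => if t ∈ B then 0 else chiColor h G G' (insert t B) with hWdef
  set a : V → V → ℝ := fun t v => ∑ B ∈ univ.powersetCard (h - 1) with v ∈ B, W t B with hadef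
  have hW : ∀ t B, t ∈ B → W t B = 0 := fun t B ht => by simp [hWdef, ht]
  have hM' : ∀ P Q : Finset V, Disjoint P Q →
      |∑ t ∈ P, ∑ B ∈ Q.powersetCard (h - 1), W t B| ≤ M := by
    intro P Q hPQ
    convert hM P Q hPQ using 4 with t ht B hB
    have : t ∉ B := fun htB =>
      disjoint_left.1 hPQ ht ((mem_powersetCard.1 hB).1 htB)
    simp [hWdef, this]
  have hlin : ∀ (x : V → ℝ) (t : V),
      ∑ B ∈ univ.powersetCard (h - 1), W t B * ∑ v ∈ B, x v = ∑ v, a t v * x v := by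
    intro x t
    simp only [hadef, sum_mul, sum_filter]
    rw [sum_comm]
    refine sum_congr rfl fun B _ => ?_
    simp [mul_sum, ite_mul]
  have hsq : ∀ t, ℓ * √(#(D t) : ℝ) ≤ √(∑ v, a t v ^ 2) := by
    intro t
    rw [← Real.sqrt_sq hℓ, ← Real.sqrt_mul (sq_nonneg ℓ)]
    refine Real.sqrt_le_sqrt ?_
    calc ℓ ^ 2 * #(D t) = ∑ v ∈ D t, ℓ ^ 2 := by rw [sum_const, nsmul_eq_mul, mul_comm]
      _ ≤ ∑ v ∈ D t, a t v ^ 2 := by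
        refine sum_le_sum fun v hv => ?_
        rw [hD, mem_filter] at hv
        have htv : t ≠ v := hv.2.elim (fun h => h.1.ne) (fun h => h.1.ne)
        have h1 := abs_linear_coeff_ge hcl hcl' hv.2
        rw [← sum_powersetCard_insert_eq (by omega) _ htv] at h1
        have h2 : a t v = ∑ B ∈ univ.powersetCard (h - 1) with t ∉ B ∧ v ∈ B,
            chiColor h G G' (insert t B) := by
          simp only [hadef, hWdef, sum_filter]
          refine sum_congr rfl fun B _ => ?_
          by_cases h3 : t ∈ B <;> by_cases h4 : v ∈ B <;> simp [h3, h4]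
        rw [← h2] at h1
        rw [← sq_abs (a t v)]
        gcongr
      _ ≤ ∑ v, a t v ^ 2 :=
        sum_le_sum_of_subset_of_nonneg (subset_univ _) fun _ _ _ => sq_nonneg _
  have hupper : ∑ X ∈ (univ : Finset V).powerset, ∑ t, |∑ v, a t v * signVec X v|
      ≤ 2 ^ Fintype.card V * (4 * 12 ^ (h - 1) * M) := by
    calc _ ≤ ∑ X ∈ (univ : Finset V).powerset, 4 * 12 ^ (h - 1) * M := by
          refine sum_le_sum fun X _ => ?_
          have := sum_abs_linear_part_le (by omega) hW hM' (x := signVec X)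
            (fun v => by unfold signVec; split_ifs <;> simp)
          simpa only [hlin] using this
      _ = _ := by rw [sum_const, card_powerset, nsmul_eq_mul, card_univ]; push_cast; rfl
  have hlower : 2 ^ Fintype.card V * (5 / 9 * ℓ * ∑ t : V, √(#(D t) : ℝ))
      ≤ ∑ X ∈ (univ : Finset V).powerset, ∑ t, |∑ v, a t v * signVec X v| := by
    rw [sum_comm, mul_sum, mul_sum]
    refine sum_le_sum fun t _ => ?_
    refine le_trans ?_ (rademacher_abs_ge (a t) univ)
    rw [card_univ]
    calc _ = 5 / 9 * 2 ^ Fintype.card V * (ℓ * √(#(D t) : ℝ)) := by ring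
      _ ≤ _ := by gcongr; exact hsq t
  exact le_of_mul_le_mul_left (hlower.trans hupper) (by positivity)

theorem ellh_nonneg (h : ℕ) (G : SimpleGraph V) : 0 ≤ ellh h G :=
  Real.iSup_nonneg fun p => by split_ifs <;> positivity

omit [DecidableEq V] in
/-- A lower bound for a sum of square roots of numbers bounded by `4 * c`. -/
theorem sum_sqrt_ge {c : ℝ} {f : V → ℝ} (hf : ∀ t, 0 ≤ f t) (hfc : ∀ t, f t ≤ 4 * c) :
    ∑ t, f t ≤ 2 * √c * ∑ t, √(f t) := by
  rw [mul_sum]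
  refine sum_le_sum fun t _ => ?_
  have h1 : √(f t) ≤ 2 * √c := by
    rw [show (2 : ℝ) * √c = √(4 * c) by
      rw [Real.sqrt_mul (by norm_num), show (4 : ℝ) = 2 ^ 2 by norm_num,
        Real.sqrt_sq (by norm_num)]]
    exact Real.sqrt_le_sqrt (hfc t)
  calc f t = √(f t) * √(f t) := (Real.mul_self_sqrt (hf t)).symm
    _ ≤ _ := by gcongr

theorem discrepancy_main (h : ℕ) (hh : 2 ≤ h) (γ σ : ℝ)
    (hγ : γ ∈ Set.Ioo (0 : ℝ) (1 / 2)) (hσ : σ ∈ Set.Ioo (0 : ℝ) (1 / 2))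
    (G G' : SimpleGraph V) (n : ℕ) (hn : n = Fintype.card V)
    (hsym : σ * γ * (n : ℝ) ^ 2 ≤ ((symmDiff (edgeFinset' G) (edgeFinset' G')).card : ℝ))
    (hdeg : ∀ v : V, γ * n / 2 ≤ (degreeCount G v : ℝ) ∧ (degreeCount G v : ℝ) ≤ 2 * γ * n)
    (hdeg' : ∀ v : V, γ * n / 2 ≤ (degreeCount G' v : ℝ) ∧ (degreeCount G' v : ℝ) ≤ 2 * γ * n)
    (hcl : ∀ a b : V, G.Adj a b →
      ellh h G / 2 ≤ (cliqueCountOnEdge h G a b : ℝ) ∧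
        (cliqueCountOnEdge h G a b : ℝ) ≤ 2 * ellh h G)
    (hcl' : ∀ a b : V, G'.Adj a b →
      ellh h G / 2 ≤ (cliqueCountOnEdge h G' a b : ℝ) ∧
        (cliqueCountOnEdge h G' a b : ℝ) ≤ 2 * ellh h G)
    (hcn : ∀ i : ℕ, 1 ≤ i → i ≤ h → ∀ B : Finset V, B.card = i →
      (n : ℝ) * γ ^ i / 2 ≤ ((commonNbrs G B).card : ℝ) ∧
        ((commonNbrs G B).card : ℝ) ≤ 2 * n * γ ^ i)
    (hcn' : ∀ i : ℕ, 1 ≤ i → i ≤ h → ∀ B : Finset V, B.card = i →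
      (n : ℝ) * γ ^ i / 2 ≤ ((commonNbrs G' B).card : ℝ) ∧
        ((commonNbrs G' B).card : ℝ) ≤ 2 * n * γ ^ i) :
    ∃ P Q : Finset V, Disjoint P Q ∧
      ((2 : ℝ) ^ (h * h + h + 7))⁻¹ * σ * Real.sqrt γ * n * Real.sqrt n * ellh h G ≤
        |∑ t ∈ P, ∑ B ∈ Q.powersetCard (h - 1), chiColor h G G' (insert t B)| := by
  have hℓ := ellh_nonneg h G
  set ℓ := ellh h G with hℓdef
  have hγ0 := hγ.1
  have hσ0 := hσ.1
  by_contra hcon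
  push Not at hcon
  set X : ℝ := σ * √γ * n * √n * ℓ with hX
  have hX0 : 0 < X := by
    have h1 := hcon ∅ ∅ (disjoint_empty_left _)
    have h2 : (0 : ℝ) ≤ X := by positivity
    refine h2.lt_of_ne fun h3 => ?_
    have h4 : ((2 : ℝ) ^ (h * h + h + 7))⁻¹ * σ * √γ * n * √n * ℓ
        = ((2 : ℝ) ^ (h * h + h + 7))⁻¹ * X := by rw [hX]; ring
    rw [h4, ← h3] at h1
    simp at h1
  have hn0 : (0 : ℝ) < n := by
    rcases Nat.eq_zero_or_pos n with h0 | h0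
    · simp [hX, h0] at hX0
    · exact_mod_cast h0
  set δ : V → ℝ := fun t =>
    (#{v | (G.Adj t v ∧ ¬ G'.Adj t v) ∨ (G'.Adj t v ∧ ¬ G.Adj t v)} : ℝ) with hδ
  have hmain := sum_sqrt_degree_symmDiff_le hh (G := G) (G' := G') (ℓ := ℓ / 2) (by positivity)
    (fun a b hab => (hcl a b hab).1) (fun a b hab => (hcl' a b hab).1)
    (fun P Q hPQ => (hcon P Q hPQ).le)
  have hδc : ∀ t, δ t ≤ 4 * (γ * n) := by
    intro t
    have h1 : δ t ≤ degreeCount G t + degreeCount G' t := by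
      simp only [hδ, filter_or, degreeCount]
      exact_mod_cast (card_union_le _ _).trans (add_le_add
        (card_le_card (monotone_filter_right _ fun _ _ hv => And.left hv))
        (card_le_card (monotone_filter_right _ fun _ _ hv => And.left hv)))
    linarith [(hdeg t).2, (hdeg' t).2]
  have hsqrt := sum_sqrt_ge (c := γ * n) (fun t => Nat.cast_nonneg _) hδc
  have hsum : 2 * (σ * γ * n ^ 2) ≤ ∑ t, δ t := by
    have h1 := sum_degree_symmDiff G G'
    have h2 : ∑ t, δ t = 2 * (#(symmDiff (edgeFinset' G) (edgeFinset' G')) : ℝ) := by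
      simp only [hδ]
      exact_mod_cast h1
    linarith
  have hroot : σ * √γ * n * √n ≤ ∑ t, √(δ t) := by
    have h1 : 0 < √(γ * n) := Real.sqrt_pos.2 (by positivity)
    have h2 : √(γ * n) * (σ * √γ * n * √n) = σ * γ * n ^ 2 := by
      rw [Real.sqrt_mul hγ0.le]
      calc _ = σ * n * (√γ * √γ) * (√n * √n) := by ring
        _ = _ := by
          rw [Real.mul_self_sqrt hγ0.le, Real.mul_self_sqrt hn0.le]
          ring
    refine le_of_mul_le_mul_left ?_ h1
    linarith
  have hlow : 5 / 18 * X ≤ 4 * 12 ^ (h - 1) * ((2 ^ (h * h + h + 7))⁻¹ * X) := by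
    calc 5 / 18 * X = 5 / 9 * (ℓ / 2) * (σ * √γ * n * √n) := by rw [hX]; ring
      _ ≤ 5 / 9 * (ℓ / 2) * ∑ t, √(δ t) := by gcongr
      _ ≤ _ := hmain
      _ = _ := by rw [hX]; ring
  have hconst : (4 : ℝ) * 12 ^ (h - 1) * (2 ^ (h * h + h + 7))⁻¹ ≤ 1 / 4 := by
    rw [← div_eq_mul_inv, div_le_iff₀ (by positivity)]
    calc (4 : ℝ) * 12 ^ (h - 1) ≤ 4 * 16 ^ (h - 1) := by gcongr; norm_num
      _ = 1 / 4 * 2 ^ (4 * h) := by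
        obtain ⟨k, rfl⟩ : ∃ k, h = k + 1 := ⟨h - 1, by omega⟩
        rw [pow_mul, Nat.add_sub_cancel, pow_succ]
        norm_num
        ring
      _ ≤ 1 / 4 * 2 ^ (h * h + h + 7) := by
        gcongr
        · norm_num
        · nlinarith [sq_nonneg ((h : ℤ) - 2)]
  nlinarith
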